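/- arXiv:1705.01800 — 2 statements merged into one kernel-verified Lean document; each statement's English description precedes it below -/
import Mathlib

section
/- Fix an integer n ≥ 2 and define the weight w_n(j) = 2^{n-1} if j is odd and w_n(j) = 2^n if j is even. Let W_n(r) = Σ_{β ∈ S_r} Π_{cycles c of β} w_n(length of c), where the product runs over all cycles of β including fixed points as cycles of length 1 (and W_n(0) = 1, the empty sum over S_0 being 1). Then for every positive integer r, W_n(r) ≥ r · W_n(r-1). (This is the inequality Z_{S_r}(2^{n-1}, 2^n, 2^{n-1}, 2^n, …) ≥ Z_{S_{r-1}}(2^{n-1}, 2^n, 2^{n-1}, 2^n, …).) -/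
/-- Orbit relation on `α` of the cyclic group generated by the permutation `σ`:
two points are related iff some power of `σ` maps one to the other. -/
def permOrbRel {α : Type*} (σ : Equiv.Perm α) (x y : α) : Prop :=
  ∃ k : ℤ, (σ ^ k) x = y

/-- Number of cycles of a permutation, counting fixed points as cycles of length 1:
the number of orbits of the subgroup generated by `σ`. -/
noncomputable def cycleCount {α : Type*} (σ : Equiv.Perm α) : ℕ :=
  Nat.card (Quot (permOrbRel σ))

/-- The size (length) of a cycle of a permutation, viewed as an orbit class. -/
noncomputable def orbSize {α : Type*} {r : α → α → Prop} (q : Quot r) : ℕ :=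
  Nat.card {x // Quot.mk r x = q}

/-- The weight `w_n(j)`: `2^(n-1)` for odd `j` and `2^n` for even `j`. -/
def wWeight (n j : ℕ) : ℕ := if Odd j then 2 ^ (n - 1) else 2 ^ n

/-- `W n r = Σ_{β ∈ S_r} Π_{cycles c of β} w_n(length of c)`, the cycle index
polynomial of `S_r` evaluated at `x_j = w_n(j)` and multiplied by `r!`. -/
noncomputable def W (n r : ℕ) : ℕ :=
  ∑ β : Equiv.Perm (Fin r), ∏ᶠ c : Quot (permOrbRel β), wWeight n (orbSize c)

section OrbitColorings

variable {α β : Type*}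

theorem permOrbRel_equivalence (σ : Equiv.Perm α) : Equivalence (permOrbRel σ) where
  refl _ := ⟨0, rfl⟩
  symm := by
    rintro x _ ⟨k, rfl⟩
    exact ⟨-k, by simp⟩
  trans := by
    rintro x _ _ ⟨k, rfl⟩ ⟨l, rfl⟩
    exact ⟨l + k, by rw [zpow_add, Equiv.Perm.mul_apply]⟩

theorem quot_mk_permOrbRel_eq_iff (σ : Equiv.Perm α) (x y : α) :
    Quot.mk (permOrbRel σ) x = Quot.mk (permOrbRel σ) y ↔ permOrbRel σ x y :=
  (permOrbRel_equivalence σ).quot_mk_eq_iff x y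

theorem orbSize_mk (σ : Equiv.Perm α) (x : α) :
    orbSize (Quot.mk (permOrbRel σ) x) = Nat.card {y // permOrbRel σ x y} :=
  Nat.card_congr <| Equiv.subtypeEquivRight fun y => by
    rw [quot_mk_permOrbRel_eq_iff]
    exact ⟨(permOrbRel_equivalence σ).symm, (permOrbRel_equivalence σ).symm⟩

/-- `g` is constant on the cycles of `σ`, and uses one of the `w j` colors `0, …, w j - 1` on
each cycle of length `j`. -/
def IsCycleColoring (w : ℕ → ℕ) (σ : Equiv.Perm α) (g : α → ℕ) : Prop :=
  (∀ x, g (σ x) = g x) ∧ ∀ x, g x < w (orbSize (Quot.mk (permOrbRel σ) x))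

theorem apply_zpow_of_invariant {σ : Equiv.Perm α} {g : α → β} (h : ∀ x, g (σ x) = g x)
    (k : ℤ) (x : α) : g ((σ ^ k) x) = g x := by
  induction k with
  | zero => rfl
  | succ k ih => rw [add_comm, zpow_add, Equiv.Perm.mul_apply, zpow_one, h, ih]
  | pred k ih =>
    rw [← ih, ← h, ← Equiv.Perm.mul_apply, ← zpow_one_add]
    congr 3
    ring

/-- Colorings of the cycles of `σ` as families indexed by the cycles. -/
def cycleColoringEquiv (w : ℕ → ℕ) (σ : Equiv.Perm α) :
    {g : α → ℕ // IsCycleColoring w σ g} ≃ ((q : Quot (permOrbRel σ)) → Fin (w (orbSize q))) where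
  toFun g q := ⟨Quot.lift g.1 (by
      rintro x _ ⟨k, rfl⟩
      exact (apply_zpow_of_invariant g.2.1 k x).symm) q, by
    induction q using Quot.ind with
    | mk x => exact g.2.2 x⟩
  invFun c := ⟨fun x => c (Quot.mk _ x), fun x => by
      have h : Quot.mk (permOrbRel σ) (σ x) = Quot.mk (permOrbRel σ) x :=
        (Quot.sound ⟨1, by simp⟩).symm
      exact congrArg (fun q => (c q : ℕ)) h, fun x => (c (Quot.mk _ x)).2⟩
  left_inv _ := rfl
  right_inv c := by
    funext q
    induction q using Quot.ind with
    | mk x => rfl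

/-- An embedding that intertwines two permutations along an orbit preserves its length. -/
theorem orbSize_eq_of_zpow_apply {σ : Equiv.Perm α} {τ : Equiv.Perm β} {e : α → β}
    (he : Function.Injective e) {x : α} (h : ∀ k : ℤ, (τ ^ k) (e x) = e ((σ ^ k) x)) :
    orbSize (Quot.mk (permOrbRel τ) (e x)) = orbSize (Quot.mk (permOrbRel σ) x) := by
  rw [orbSize_mk, orbSize_mk]
  refine (Nat.card_congr (Equiv.ofBijective
    (fun y : {y // permOrbRel σ x y} => (⟨e y.1, ?_⟩ : {y // permOrbRel τ (e x) y})) ⟨?_, ?_⟩)).symm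
  · obtain ⟨y, k, rfl⟩ := y
    exact ⟨k, h k⟩
  · intro y z hyz
    exact Subtype.ext (he (congrArg Subtype.val hyz))
  · rintro ⟨_, k, rfl⟩
    exact ⟨⟨(σ ^ k) x, k, rfl⟩, Subtype.ext (h k).symm⟩

theorem zpow_apply_of_semiconj_on {σ : Equiv.Perm α} {τ : Equiv.Perm β} {e : α → β}
    {p : α → Prop} (hp : ∀ x, p (σ x) ↔ p x) (h : ∀ x, p x → τ (e x) = e (σ x))
    {x : α} (hx : p x) (k : ℤ) : (τ ^ k) (e x) = e ((σ ^ k) x) := by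
  have hp' (k : ℤ) : p ((σ ^ k) x) :=
    (apply_zpow_of_invariant (fun x => propext (hp x)) k x).mpr hx
  induction k with
  | zero => rfl
  | succ k ih =>
    rw [add_comm, zpow_add, zpow_add, Equiv.Perm.mul_apply, ih, zpow_one, zpow_one, h _ (hp' _),
      Equiv.Perm.mul_apply]
  | pred k ih =>
    apply τ.injective
    rw [h _ (hp' _), ← Equiv.Perm.mul_apply, ← Equiv.Perm.mul_apply, ← zpow_one_add,
      ← zpow_one_add]
    convert ih using 3 <;> ring_nf

end OrbitColorings

/-- Permutations of `Fin r` together with a coloring of their cycles. -/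
abbrev ColoredPerm (w : ℕ → ℕ) (r : ℕ) : Type :=
  Σ σ : Equiv.Perm (Fin r), {g : Fin r → ℕ // IsCycleColoring w σ g}

instance (w : ℕ → ℕ) (r : ℕ) (σ : Equiv.Perm (Fin r)) :
    Finite {g : Fin r → ℕ // IsCycleColoring w σ g} :=
  Finite.of_equiv _ (cycleColoringEquiv w σ).symm

theorem card_coloredPerm (w : ℕ → ℕ) (r : ℕ) :
    Nat.card (ColoredPerm w r) =
      ∑ σ : Equiv.Perm (Fin r), ∏ᶠ q : Quot (permOrbRel σ), w (orbSize q) := by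
  rw [Nat.card_sigma]
  refine Finset.sum_congr rfl fun σ _ => ?_
  have := Fintype.ofFinite (Quot (permOrbRel σ))
  rw [Nat.card_congr (cycleColoringEquiv w σ), Nat.card_pi, finprod_eq_prod_of_fintype]
  simp

/-- The permutation of `Fin (m + 1)` fixing `i` and acting as `σ` on the other elements. -/
def extendFixing {m : ℕ} (i : Fin (m + 1)) (σ : Equiv.Perm (Fin m)) : Equiv.Perm (Fin (m + 1)) :=
  ((finSuccEquiv' i).trans (Equiv.optionCongr σ)).trans (finSuccEquiv' i).symm

@[simp]
theorem extendFixing_self {m : ℕ} (i : Fin (m + 1)) (σ : Equiv.Perm (Fin m)) :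
    extendFixing i σ i = i := by
  simp [extendFixing]

@[simp]
theorem extendFixing_succAbove {m : ℕ} (i : Fin (m + 1)) (σ : Equiv.Perm (Fin m)) (x : Fin m) :
    extendFixing i σ (i.succAbove x) = i.succAbove (σ x) := by
  simp [extendFixing]

theorem extendFixing_injective {m : ℕ} (i : Fin (m + 1)) :
    Function.Injective (extendFixing i) := by
  intro σ τ h
  ext1 x
  have := congrArg (fun e => e (i.succAbove x)) h
  simpa using this

/-- Insert `i` with color `0`, placing it right after a chosen element of color `0`. -/
noncomputable def insertColorZero {m : ℕ} (i : Fin (m + 1)) (σ : Equiv.Perm (Fin m))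
    (g : Fin m → ℕ) : Equiv.Perm (Fin (m + 1)) :=
  extendFixing i σ * Equiv.swap (Function.invFun (i.insertNth 0 g : Fin (m + 1) → ℕ) 0) i

theorem isCycleColoring_insertColorZero {w : ℕ → ℕ} (hw : ∀ j, 0 < w j) {m : ℕ}
    (i : Fin (m + 1)) {σ : Equiv.Perm (Fin m)} {g : Fin m → ℕ} (hg : IsCycleColoring w σ g) :
    IsCycleColoring w (insertColorZero i σ g) (i.insertNth 0 g : Fin (m + 1) → ℕ) := by
  set G : Fin (m + 1) → ℕ := i.insertNth 0 g with hG
  have hGi : G i = 0 := by simp [hG]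
  have hGs (x : Fin m) : G (i.succAbove x) = g x := by simp [hG]
  have hb : G (Function.invFun G 0) = 0 := Function.invFun_eq ⟨i, hGi⟩
  have hext (x : Fin (m + 1)) : G (extendFixing i σ x) = G x := by
    cases x using Fin.succAboveCases i with
    | x => simp
    | p x => simp [hGs, hg.1]
  have hswap (x : Fin (m + 1)) : G (Equiv.swap (Function.invFun G 0) i x) = G x := by
    rw [Equiv.swap_apply_def]
    split_ifs with h₁ h₂
    · rw [h₁, hb, hGi]
    · rw [h₂, hb, hGi]
    · rfl
  refine ⟨fun x => ?_, fun x => ?_⟩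
  · rw [insertColorZero, Equiv.Perm.mul_apply, hext, hswap]
  · cases x using Fin.succAboveCases i with
    | x => simpa [hGi] using hw _
    | p x =>
      rcases Nat.eq_zero_or_pos (g x) with h0 | hpos
      · simpa [hGs, h0] using hw _
      · rw [hGs, orbSize_eq_of_zpow_apply (σ := σ) Fin.succAbove_right_injective]
        · exact hg.2 x
        · refine zpow_apply_of_semiconj_on (p := fun x => 0 < g x) (fun x => by rw [hg.1])
            (fun y hy => ?_) hpos
          rw [insertColorZero, Equiv.Perm.mul_apply, Equiv.swap_apply_of_ne_of_ne,
            extendFixing_succAbove]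
          · intro h
            have := hGs y
            rw [h, hb] at this
            omega
          · exact Fin.succAbove_ne i y

theorem card_coloredPerm_succ_ge {w : ℕ → ℕ} (hw : ∀ j, 0 < w j) (m : ℕ) :
    (m + 1) * Nat.card (ColoredPerm w m) ≤ Nat.card (ColoredPerm w (m + 1)) := by
  have key := Nat.card_le_card_of_injective
    (fun t : Fin (m + 1) × ColoredPerm w m =>
      (⟨insertColorZero t.1 t.2.1 t.2.2.1, _,
        isCycleColoring_insertColorZero hw t.1 t.2.2.2⟩ : ColoredPerm w (m + 1))) ?_
  · simpa [Nat.card_prod] using key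
  · rintro ⟨i, σ, g, hg⟩ ⟨j, τ, f, hf⟩ h
    have hperm : insertColorZero i σ g = insertColorZero j τ f := congrArg Sigma.fst h
    have hcol : (i.insertNth 0 g : Fin (m + 1) → ℕ) = j.insertNth 0 f :=
      congrArg (fun t : ColoredPerm w (m + 1) => t.2.1) h
    have hij : i = j := by
      have := congrArg
        (fun e => e (Function.invFun (i.insertNth 0 g : Fin (m + 1) → ℕ) 0)) hperm
      simpa [insertColorZero, ← hcol] using this
    subst hij
    have hgf : g = f := by
      funext x
      simpa using congrFun hcol (i.succAbove x)
    subst hgf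
    have hστ : σ = τ := extendFixing_injective i (mul_right_cancel hperm)
    subst hστ
    rfl

theorem W_eq_card_coloredPerm (n r : ℕ) : W n r = Nat.card (ColoredPerm (wWeight n) r) :=
  (card_coloredPerm _ _).symm

theorem wWeight_pos (n j : ℕ) : 0 < wWeight n j := by
  unfold wWeight
  split_ifs <;> positivity

/-- `Z_{S_r}(2^{n-1}, 2^n, 2^{n-1}, 2^n, …) ≥ Z_{S_{r-1}}(2^{n-1}, 2^n, …)` for
`n ≥ 2`, stated as `W_n(r) ≥ r · W_n(r-1)`. -/
theorem W_ge_mul_W_pred (n : ℕ) (hn : 2 ≤ n) (r : ℕ) (hr : 0 < r) :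
    r * W n (r - 1) ≤ W n r := by
  obtain ⟨m, rfl⟩ := Nat.exists_eq_add_of_lt hr
  simp only [zero_add, Nat.add_sub_cancel, W_eq_card_coloredPerm]
  exact card_coloredPerm_succ_ge (wWeight_pos n) m
end

section
/- Let n and r be integers with 2 ≤ n < r, let τ be any transposition in S_n (a permutation of Fin n exchanging two elements and fixing the rest), and let σ be any permutation of Fin n that is not the identity. Then Σ_{β ∈ S_r} 2^{c(τ × β)} ≥ Σ_{β ∈ S_r} 2^{c(σ × β)}, where for a permutation γ of Fin n, γ × β is the permutation of Fin n × Fin r given by (i,j) ↦ (γ i, β j), and c denotes the number of cycles including fixed points. (This states that among all non-identity terms of the cycle index of S_n, the term of a transposition contributes the largest amount to Z_{S_n × S_r}(2,…,2).) -/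
section

open Equiv

def fiberCard {ι X : Type*} [Fintype ι] [DecidableEq X] (φ : ι → X) (x : X) : ℕ :=
  Fintype.card {j // φ j = x}

theorem exists_fiberCard_eq {ι X : Type*} [Fintype ι] [Fintype X] [DecidableEq X]
    (m : X → ℕ) (hm : ∑ x, m x = Fintype.card ι) : ∃ φ : ι → X, fiberCard φ = m := by
  have h : Fintype.card ι = Fintype.card (Σ x, Fin (m x)) := by simp [hm]
  let e := Fintype.equivOfCardEq h
  refine ⟨fun j => (e j).1, funext fun x => ?_⟩
  rw [fiberCard, Fintype.card_congr (e.subtypeEquiv (q := fun p => p.1 = x) fun _ => Iff.rfl),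
    Fintype.card_congr (Equiv.sigmaSubtype (β := fun x => Fin (m x)) x), Fintype.card_fin]

theorem exists_perm_of_fiberCard_eq {ι X : Type*} [Fintype ι] [DecidableEq X]
    {φ ψ : ι → X} (h : fiberCard φ = fiberCard ψ) : ∃ β : Perm ι, ∀ j, φ (β j) = ψ j := by
  let e (x : X) : {j // ψ j = x} ≃ {j // φ j = x} := Fintype.equivOfCardEq (congrFun h x).symm
  refine ⟨(Equiv.sigmaFiberEquiv ψ).symm.trans
    ((Equiv.sigmaCongrRight e).trans (Equiv.sigmaFiberEquiv φ)), fun j => ?_⟩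
  exact (e (ψ j) ⟨j, rfl⟩).2

theorem fiberCard_comp_perm {ι X : Type*} [Fintype ι] [DecidableEq X]
    (φ : ι → X) (β : Perm ι) : fiberCard (φ ∘ β) = fiberCard φ :=
  funext fun _ => Fintype.card_congr (β.subtypeEquiv fun _ => Iff.rfl)

theorem fiberCard_perm_comp {ι X : Type*} [Fintype ι] [DecidableEq X]
    (φ : ι → X) (g : Perm X) (x : X) : fiberCard (g ∘ φ) (g x) = fiberCard φ x :=
  Fintype.card_congr (Equiv.subtypeEquivRight fun _ => g.injective.eq_iff)

/-- The `g`-invariant weights on `X` of total weight `r`. -/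
def invariantWeights {X : Type*} [Fintype X] [DecidableEq X] (g : Perm X) (r : ℕ) :
    Finset (X → ℕ) :=
  {m ∈ Finset.piAntidiag Finset.univ r | ∀ x, m (g x) = m x}

theorem mem_invariantWeights {X : Type*} [Fintype X] [DecidableEq X] {g : Perm X} {r : ℕ}
    {m : X → ℕ} : m ∈ invariantWeights g r ↔ ∑ x, m x = r ∧ ∀ x, m (g x) = m x := by
  simp [invariantWeights]

theorem sum_fiberCard {ι X : Type*} [Fintype ι] [Fintype X] [DecidableEq X] (φ : ι → X) :
    ∑ x, fiberCard φ x = Fintype.card ι := by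
  simp only [fiberCard]
  rw [← Fintype.card_sigma, Fintype.card_congr (Equiv.sigmaFiberEquiv φ)]

theorem sum_card_intertwining_of_fiberCard {ι X : Type*} [Fintype ι] [DecidableEq ι] [Fintype X]
    [DecidableEq X] (g : Perm X) (m : X → ℕ) (hm : m ∈ invariantWeights g (Fintype.card ι)) :
    ∑ φ : ι → X with fiberCard φ = m, Fintype.card {β : Perm ι // ∀ j, φ (β j) = g (φ j)} =
      Fintype.card (Perm ι) := by
  rw [mem_invariantWeights] at hm
  obtain ⟨φ₀, h₀⟩ := exists_fiberCard_eq (ι := ι) m hm.1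
  have key (φ : ι → X) (hφ : fiberCard φ = m) :
      Fintype.card {β : Perm ι // ∀ j, φ (β j) = g (φ j)} =
        Finset.card {β : Perm ι | φ₀ ∘ β = φ} := by
    have hg : fiberCard (g ∘ φ) = m := by
      funext x
      obtain ⟨y, rfl⟩ := g.surjective x
      rw [fiberCard_perm_comp, hφ, hm.2]
    obtain ⟨a, ha⟩ := exists_perm_of_fiberCard_eq (h₀.trans hφ.symm)
    obtain ⟨b, hb⟩ := exists_perm_of_fiberCard_eq (hφ.trans hg.symm)
    rw [← Fintype.card_subtype]
    refine Fintype.card_congr (Equiv.subtypeEquiv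
      ((Equiv.mulRight b⁻¹).trans (Equiv.mulLeft a)) fun β => ?_)
    rw [funext_iff]
    refine Iff.trans (forall_congr' fun j => ?_) b.forall_congr_right
    simp [ha, hb]
  rw [Finset.sum_congr rfl fun φ hφ => key φ (Finset.mem_filter.1 hφ).2]
  exact (Finset.card_eq_sum_card_fiberwise fun β _ => by
    simpa [fiberCard_comp_perm] using h₀).symm

theorem sum_card_intertwining {ι X : Type*} [Fintype ι] [DecidableEq ι] [Fintype X]
    [DecidableEq X] (g : Perm X) :
    ∑ β : Perm ι, Fintype.card {φ : ι → X // ∀ j, φ (β j) = g (φ j)} =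
      (invariantWeights g (Fintype.card ι)).card * Fintype.card (Perm ι) := by
  have hinv (φ : ι → X) (h : Fintype.card {β : Perm ι // ∀ j, φ (β j) = g (φ j)} ≠ 0) :
      fiberCard φ ∈ invariantWeights g (Fintype.card ι) := by
    obtain ⟨β, hβ⟩ := Fintype.card_pos_iff.1 (Nat.pos_of_ne_zero h)
    refine mem_invariantWeights.2 ⟨sum_fiberCard φ, fun x => ?_⟩
    rw [← fiberCard_perm_comp φ g x, ← fiberCard_comp_perm φ β]
    exact congrFun (congrArg fiberCard (funext hβ)) _
  calc
    _ = ∑ φ : ι → X, Fintype.card {β : Perm ι // ∀ j, φ (β j) = g (φ j)} := by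
      simp only [Fintype.card_subtype, Finset.card_filter]
      exact Finset.sum_comm
    _ = ∑ φ : ι → X with fiberCard φ ∈ invariantWeights g (Fintype.card ι),
          Fintype.card {β : Perm ι // ∀ j, φ (β j) = g (φ j)} :=
      (Finset.sum_filter_of_ne fun φ _ h => hinv φ h).symm
    _ = ∑ m ∈ invariantWeights g (Fintype.card ι), Fintype.card (Perm ι) := by
      rw [← Finset.sum_fiberwise_of_maps_to (g := fiberCard)
        (t := invariantWeights g (Fintype.card ι)) fun φ hφ => (Finset.mem_filter.1 hφ).2]
      refine Finset.sum_congr rfl fun m hm => ?_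
      rw [← sum_card_intertwining_of_fiberCard g m hm, Finset.filter_filter]
      refine Finset.sum_congr (Finset.filter_congr fun φ _ => ?_) fun _ _ => rfl
      exact ⟨And.right, fun h => ⟨h ▸ hm, h⟩⟩
    _ = _ := by simp

theorem quot_mk_eq_iff_sameCycle {X : Type*} {g : Perm X} {x y : X} :
    Quot.mk (permOrbRel g) x = Quot.mk (permOrbRel g) y ↔ g.SameCycle x y :=
  Quotient.eq (r := Perm.SameCycle.setoid g)

theorem orbSize_mk_s13 {X : Type*} [Finite X] (g : Perm X) (x : X) :
    orbSize (Quot.mk (permOrbRel g) x) = Function.minimalPeriod g x := by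
  classical
  have := Fintype.ofFinite X
  have h : Function.minimalPeriod g x = _ := MulAction.minimalPeriod_eq_card (a := g) (b := x)
  rw [h, orbSize, ← Nat.card_eq_fintype_card]
  refine Nat.card_congr (Equiv.subtypeEquivRight fun y => ?_)
  rw [eq_comm, quot_mk_eq_iff_sameCycle]
  constructor
  · rintro ⟨k, rfl⟩
    exact ⟨⟨g ^ k, k, rfl⟩, rfl⟩
  · rintro ⟨⟨_, k, rfl⟩, rfl⟩
    exact ⟨k, rfl⟩

theorem orbSize_pos {X : Type*} [Finite X] {g : Perm X} (q : Quot (permOrbRel g)) :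
    0 < orbSize q := by
  obtain ⟨x, rfl⟩ := Quot.exists_rep q
  have : Nonempty {y // Quot.mk (permOrbRel g) y = Quot.mk (permOrbRel g) x} := ⟨⟨x, rfl⟩⟩
  exact Nat.card_pos

theorem sum_comp_quot_mk {X : Type*} [Fintype X] {g : Perm X} [Fintype (Quot (permOrbRel g))]
    (k : Quot (permOrbRel g) → ℕ) :
    ∑ x, k (Quot.mk _ x) = ∑ q, orbSize q * k q := by
  classical
  rw [← Finset.sum_fiberwise' Finset.univ (Quot.mk (permOrbRel g)) k]
  refine Finset.sum_congr rfl fun q _ => ?_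
  rw [Finset.sum_const, smul_eq_mul, orbSize, Nat.card_eq_fintype_card, Fintype.card_subtype]

theorem eq_apply_out_of_invariant {X M : Type*} [Finite X] {g : Perm X} {m : X → M}
    (hm : ∀ x, m (g x) = m x) (x : X) : m (Quot.mk (permOrbRel g) x).out = m x := by
  obtain ⟨i, hi⟩ := (quot_mk_eq_iff_sameCycle.1
    (Quot.out_eq (Quot.mk (permOrbRel g) x))).exists_nat_pow_eq
  generalize (Quot.mk (permOrbRel g) x).out = y at hi ⊢
  subst hi
  induction i with
  | zero => rfl
  | succ i ih => rw [pow_succ', Perm.mul_apply, hm, ← ih]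

theorem card_invariantWeights_le {X Y : Type*} [Fintype X] [DecidableEq X] [Fintype Y]
    [DecidableEq Y] (g : Perm X) (h : Perm Y) (r : ℕ)
    (j : Quot (permOrbRel g) → Quot (permOrbRel h)) (hj : Function.Injective j)
    (hdvd : ∀ q, orbSize (j q) ∣ orbSize q) :
    (invariantWeights g r).card ≤ (invariantWeights h r).card := by
  have := Fintype.ofFinite (Quot (permOrbRel g))
  have := Fintype.ofFinite (Quot (permOrbRel h))
  let F (m : X → ℕ) : Quot (permOrbRel h) → ℕ :=
    Function.extend j (fun q => orbSize q / orbSize (j q) * m q.out) 0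
  have hF (m : X → ℕ) (q) : F m (j q) = orbSize q / orbSize (j q) * m q.out :=
    hj.extend_apply _ _ _
  refine Finset.card_le_card_of_injOn (fun m y => F m (Quot.mk _ y)) (fun m hm => ?_) ?_
  · rw [Finset.mem_coe, mem_invariantWeights] at hm ⊢
    refine ⟨?_, fun y => ?_⟩
    · rw [sum_comp_quot_mk, ← hm.1, ← Finset.sum_congr rfl fun x _ =>
        eq_apply_out_of_invariant hm.2 x, sum_comp_quot_mk fun q => m q.out]
      refine (Fintype.sum_of_injective j hj _ _ (fun q hq => ?_) fun q => ?_).symm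
      · rw [show F m q = 0 from Function.extend_apply' _ _ _ hq, mul_zero]
      · rw [hF, ← mul_assoc, Nat.mul_div_cancel' (hdvd q)]
    · exact congrArg (F m) (quot_mk_eq_iff_sameCycle.2 (Perm.sameCycle_apply_left.2 .rfl))
  · intro m₁ hm₁ m₂ hm₂ heq
    rw [Finset.mem_coe, mem_invariantWeights] at hm₁ hm₂
    funext x
    rw [← eq_apply_out_of_invariant hm₁.2, ← eq_apply_out_of_invariant hm₂.2]
    generalize Quot.mk (permOrbRel g) x = q
    obtain ⟨y, hy⟩ := Quot.exists_rep (j q)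
    have := congrFun heq y
    simp only [hy, hF] at this
    exact Nat.eq_of_mul_eq_mul_left
      (Nat.div_pos (Nat.le_of_dvd (orbSize_pos q) (hdvd q)) (orbSize_pos _)) this

theorem exists_injective_extending {A B : Type*} [Finite A] [Finite B] {p : A → Prop}
    {p' : B → Prop} (hp : Nat.card {a // p a} ≤ Nat.card {b // p' b})
    (hc : Nat.card A ≤ Nat.card B) :
    ∃ j : A → B, Function.Injective j ∧ ∀ a, p a → p' (j a) := by
  classical
  have := Fintype.ofFinite A
  have := Fintype.ofFinite B
  rcases isEmpty_or_nonempty B with hB | hB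
  · have : IsEmpty A := by
      rw [← Finite.card_eq_zero_iff] at hB ⊢
      omega
    exact ⟨isEmptyElim, fun a => isEmptyElim a, fun a => isEmptyElim a⟩
  simp only [Nat.card_eq_fintype_card] at hp hc
  obtain ⟨i⟩ := Function.Embedding.nonempty_of_card_le hp
  let f (a : A) : B := if h : p a then i ⟨a, h⟩ else Classical.arbitrary B
  have hf (a) (h : p a) : f a = i ⟨a, h⟩ := dif_pos h
  have hinj : Set.InjOn f (Finset.univ.filter p) := by
    intro a ha b hb hab
    simp only [Finset.coe_filter, Finset.mem_univ, true_and, Set.mem_ofPred_eq] at ha hb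
    rw [hf a ha, hf b hb] at hab
    simpa using i.injective (Subtype.ext hab)
  obtain ⟨t, ht, -, hcard⟩ := Finset.exists_subsuperset_card_eq
    (s := (Finset.univ.filter p).image f) (t := Finset.univ) (n := Fintype.card A)
    (Finset.subset_univ _) (Finset.card_image_le.trans (Finset.card_le_univ _)) (by simpa)
  obtain ⟨e, he⟩ := Finset.exists_equiv_extend_of_card_eq hcard.symm ht hinj
  refine ⟨fun a => e a, Subtype.val_injective.comp e.injective, fun a ha => ?_⟩
  show p' (e a : B)
  rw [he a (by simpa), hf a ha]
  exact (i _).2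

theorem card_quot_subtype_le {X : Type*} [Finite X] {g : Perm X} {p : Quot (permOrbRel g) → Prop}
    {p' : X → Prop} (h : ∀ x, p (Quot.mk _ x) → p' x) :
    Nat.card {q // p q} ≤ Nat.card {x // p' x} := by
  refine Nat.card_le_card_of_injective
    (fun q => ⟨q.1.out, h _ (by rw [Quot.out_eq]; exact q.2)⟩) fun q₁ q₂ hq => Subtype.ext ?_
  rw [← Quot.out_eq q₁.1, ← Quot.out_eq q₂.1]
  exact congrArg (Quot.mk _) (congrArg Subtype.val hq)

theorem card_fixed_le_card_orbSize_eq_one {X : Type*} [Finite X] (g : Perm X) :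
    Nat.card {x // g x = x} ≤ Nat.card {q : Quot (permOrbRel g) // orbSize q = 1} := by
  refine Nat.card_le_card_of_injective (fun x => ⟨Quot.mk _ x.1, ?_⟩) fun x y hxy => ?_
  · rw [orbSize_mk_s13, Function.minimalPeriod_eq_one_iff_isFixedPt]
    exact x.2
  · exact Subtype.ext ((quot_mk_eq_iff_sameCycle.1 (congrArg Subtype.val hxy)).eq_of_left x.2)

theorem sum_orbSize {X : Type*} [Fintype X] (g : Perm X) [Fintype (Quot (permOrbRel g))] :
    ∑ q : Quot (permOrbRel g), orbSize q = Nat.card X := by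
  simpa using (sum_comp_quot_mk (g := g) fun _ => 1).symm

theorem exists_injective_orbSize_dvd {X Y : Type*} [Finite X] [Finite Y] {g : Perm X}
    {h : Perm Y} (hXY : Nat.card X = Nat.card Y)
    (hodd : 2 * Nat.card {q : Quot (permOrbRel g) // Odd (orbSize q)} ≤ Nat.card X)
    (hfix : Nat.card Y ≤ 2 * Nat.card {q : Quot (permOrbRel h) // orbSize q = 1})
    (h_two : ∀ q : Quot (permOrbRel h), orbSize q ≤ 2) :
    ∃ j : Quot (permOrbRel g) → Quot (permOrbRel h),
      Function.Injective j ∧ ∀ q, orbSize (j q) ∣ orbSize q := by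
  classical
  have := Fintype.ofFinite X
  have := Fintype.ofFinite Y
  have := Fintype.ofFinite (Quot (permOrbRel g))
  have := Fintype.ofFinite (Quot (permOrbRel h))
  have hg : 2 * Nat.card (Quot (permOrbRel g)) ≤
      Nat.card X + Nat.card {q : Quot (permOrbRel g) // Odd (orbSize q)} := by
    rw [← sum_orbSize g, Nat.card_eq_fintype_card (α := {q // _}), Fintype.card_subtype,
      Finset.card_filter, ← Finset.sum_add_distrib, Nat.card_eq_fintype_card, mul_comm,
      ← smul_eq_mul, ← Finset.card_univ, ← Finset.sum_const]
    refine Finset.sum_le_sum fun q _ => ?_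
    have := orbSize_pos q
    split_ifs with ho
    · omega
    · rw [Nat.not_odd_iff_even] at ho
      obtain ⟨c, hc⟩ := ho
      omega
  have hh : Nat.card Y + Nat.card {q : Quot (permOrbRel h) // orbSize q = 1} ≤
      2 * Nat.card (Quot (permOrbRel h)) := by
    rw [← sum_orbSize h, Nat.card_eq_fintype_card (α := {q // _}), Fintype.card_subtype,
      Finset.card_filter, ← Finset.sum_add_distrib, Nat.card_eq_fintype_card, mul_comm 2,
      ← smul_eq_mul, ← Finset.card_univ, ← Finset.sum_const]
    refine Finset.sum_le_sum fun q _ => ?_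
    have := h_two q
    split_ifs <;> omega
  obtain ⟨j, hj, hjp⟩ := exists_injective_extending
    (p := fun q : Quot (permOrbRel g) => Odd (orbSize q))
    (p' := fun q : Quot (permOrbRel h) => orbSize q = 1) (by omega) (by omega)
  refine ⟨j, hj, fun q => ?_⟩
  by_cases ho : Odd (orbSize q)
  · rw [hjp q ho]
    exact one_dvd _
  · have h_le := h_two (j q)
    have h_pos := orbSize_pos (j q)
    rw [Nat.not_odd_iff_even] at ho
    interval_cases orbSize (j q)
    · exact one_dvd _
    · exact ho.two_dvd

/-- The permutation of the two-colorings of `α` induced by a permutation of `α`. -/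
def colorPerm {α : Type*} (σ : Perm α) : Perm (α → Bool) :=
  σ.arrowCongr (Equiv.refl Bool)

theorem colorPerm_apply {α : Type*} (σ : Perm α) (f : α → Bool) :
    colorPerm σ f = f ∘ σ.symm := rfl

theorem colorPerm_pow {α : Type*} (σ : Perm α) (k : ℕ) :
    colorPerm σ ^ k = colorPerm (σ ^ k) := by
  induction k with
  | zero => rfl
  | succ k ih =>
    rw [pow_succ, pow_succ, ih]
    rfl

theorem apply_eq_of_colorPerm_eq {α : Type*} {σ : Perm α} {f : α → Bool}
    (h : colorPerm σ f = f) (a : α) : f (σ a) = f a := by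
  have := congrFun h (σ a)
  rw [colorPerm_apply, Function.comp_apply, Equiv.symm_apply_apply] at this
  exact this.symm

theorem two_mul_card_fixed_colorPerm_le {α : Type*} [Finite α] {σ : Perm α} (hσ : σ ≠ 1) :
    2 * Nat.card {f // colorPerm σ f = f} ≤ Nat.card (α → Bool) := by
  classical
  obtain ⟨a, ha⟩ : ∃ a, σ a ≠ a := by
    by_contra! h
    exact hσ (Equiv.ext h)
  have : 2 * Nat.card {f // colorPerm σ f = f} =
      Nat.card (Bool × {f // colorPerm σ f = f}) := by simp
  rw [this]
  refine Nat.card_le_card_of_injective (fun p => Function.update p.2.1 (σ a) p.1) ?_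
  rintro ⟨b, f, hf⟩ ⟨c, f', hf'⟩ h
  have key (i) := congrFun h i
  have h₁ := apply_eq_of_colorPerm_eq hf a
  have h₁' := apply_eq_of_colorPerm_eq hf' a
  simp only [Function.update_apply] at key
  have hbc : b = c := by simpa using key (σ a)
  have hff : f = f' := by
    funext i
    have := key i
    have := key a
    grind
  subst hbc hff
  rfl

theorem four_mul_card_fixed_colorPerm_le {α : Type*} [Finite α] {σ : Perm α} (hσ : σ ≠ 1)
    (hodd : Odd (orderOf σ)) :
    4 * Nat.card {f // colorPerm σ f = f} ≤ Nat.card (α → Bool) := by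
  classical
  obtain ⟨a, ha⟩ : ∃ a, (σ ^ 2) a ≠ a := by
    by_contra! h
    have h_one : σ ^ 2 = 1 := Equiv.ext h
    rcases (Nat.dvd_prime Nat.prime_two).1 (orderOf_dvd_of_pow_eq_one h_one) with h | h
    · exact hσ (orderOf_eq_one_iff.1 h)
    · rw [h] at hodd
      exact absurd hodd (by decide)
  rw [sq, Perm.mul_apply] at ha
  have ha₁ : σ a ≠ a := fun h => ha (by rw [h, h])
  have ha₂ : σ (σ a) ≠ σ a := fun h => ha₁ (σ.injective h)
  have : 4 * Nat.card {f // colorPerm σ f = f} =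
      Nat.card ((Bool × Bool) × {f // colorPerm σ f = f}) := by simp
  rw [this]
  refine Nat.card_le_card_of_injective
    (fun p => Function.update (Function.update p.2.1 (σ a) p.1.1) (σ (σ a)) p.1.2) ?_
  rintro ⟨⟨b, d⟩, f, hf⟩ ⟨⟨c, e⟩, f', hf'⟩ h
  have key (i) := congrFun h i
  have h₁ := apply_eq_of_colorPerm_eq hf a
  have h₁' := apply_eq_of_colorPerm_eq hf' a
  have h₂ := apply_eq_of_colorPerm_eq hf (σ a)
  have h₂' := apply_eq_of_colorPerm_eq hf' (σ a)
  simp only [Function.update_apply] at key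
  have hde : d = e := by simpa using key (σ (σ a))
  have hbc : b = c := by simpa [ha₂.symm] using key (σ a)
  have hff : f = f' := by
    funext i
    have := key i
    have := key a
    grind
  subst hbc hde hff
  rfl

theorem two_mul_card_odd_orbSize_colorPerm_le {α : Type*} [Finite α] {σ : Perm α}
    (hσ : σ ≠ 1) :
    2 * Nat.card {q : Quot (permOrbRel (colorPerm σ)) // Odd (orbSize q)} ≤
      Nat.card (α → Bool) := by
  classical
  rcases Nat.even_or_odd (orderOf σ) with heven | hodd
  · obtain ⟨a, m, hm, ham⟩ := Nat.exists_eq_two_pow_mul_odd (orderOf_pos σ).ne'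
    have hne : σ ^ m ≠ 1 := fun h =>
      (Nat.not_even_iff_odd.2 hm) (heven.trans_dvd (orderOf_dvd_of_pow_eq_one h))
    refine le_trans (Nat.mul_le_mul_left 2 (card_quot_subtype_le fun f hf => ?_))
      (two_mul_card_fixed_colorPerm_le hne)
    rw [orbSize_mk_s13] at hf
    have hdvd : Function.minimalPeriod (colorPerm σ) f ∣ 2 ^ a * m := by
      refine Function.IsPeriodicPt.minimalPeriod_dvd ?_
      rw [← ham, Function.IsPeriodicPt, Function.IsFixedPt, ← Perm.coe_pow, colorPerm_pow,
        pow_orderOf_eq_one]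
      rfl
    have hper := (Function.isPeriodicPt_minimalPeriod (colorPerm σ) f).trans_dvd
      ((Nat.Coprime.pow_right a (Nat.coprime_two_right.2 hf)).dvd_of_dvd_mul_left hdvd)
    rwa [Function.IsPeriodicPt, Function.IsFixedPt, ← Perm.coe_pow, colorPerm_pow] at hper
  · have := Fintype.ofFinite α
    have := Fintype.ofFinite (Quot (permOrbRel (colorPerm σ)))
    have h_odd (q : Quot (permOrbRel (colorPerm σ))) : Odd (orbSize q) := by
      obtain ⟨f, rfl⟩ := Quot.exists_rep q
      rw [orbSize_mk_s13]
      refine hodd.of_dvd_nat (Function.IsPeriodicPt.minimalPeriod_dvd ?_)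
      rw [Function.IsPeriodicPt, Function.IsFixedPt, ← Perm.coe_pow, colorPerm_pow,
        pow_orderOf_eq_one]
      rfl
    have hF := four_mul_card_fixed_colorPerm_le hσ hodd
    have hone : Nat.card {q : Quot (permOrbRel (colorPerm σ)) // orbSize q = 1} ≤
        Nat.card {f // colorPerm σ f = f} := by
      refine card_quot_subtype_le fun f hf => ?_
      rwa [orbSize_mk_s13, Function.minimalPeriod_eq_one_iff_isFixedPt] at hf
    have hsum : 3 * Nat.card (Quot (permOrbRel (colorPerm σ))) ≤ Nat.card (α → Bool) +
        2 * Nat.card {q : Quot (permOrbRel (colorPerm σ)) // orbSize q = 1} := by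
      rw [← sum_orbSize (colorPerm σ), Nat.card_eq_fintype_card (α := {q // _}),
        Fintype.card_subtype, Finset.card_filter, Finset.mul_sum, ← Finset.sum_add_distrib,
        Nat.card_eq_fintype_card, mul_comm, ← smul_eq_mul, ← Finset.card_univ,
        ← Finset.sum_const]
      refine Finset.sum_le_sum fun q _ => ?_
      obtain ⟨c, hc⟩ := h_odd q
      split_ifs <;> omega
    have hle : Nat.card {q : Quot (permOrbRel (colorPerm σ)) // Odd (orbSize q)} ≤
        Nat.card (Quot (permOrbRel (colorPerm σ))) :=
      Nat.card_le_card_of_injective _ Subtype.val_injective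
    omega

theorem card_le_two_mul_card_fixed_colorPerm_swap {α : Type*} [Finite α] [DecidableEq α]
    (a b : α) :
    Nat.card (α → Bool) ≤ 2 * Nat.card {f // colorPerm (swap a b) f = f} := by
  have : 2 * Nat.card {f // colorPerm (swap a b) f = f} =
      Nat.card (Bool × {f // colorPerm (swap a b) f = f}) := by simp
  rw [this]
  refine Nat.card_le_card_of_injective
    (fun f => ⟨f a, Function.update f a (f b), ?_⟩) fun f f' h => ?_
  · funext i
    simp only [colorPerm_apply, Equiv.symm_swap, Function.comp_apply, Function.update_apply,
      swap_apply_def]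
    grind
  · simp only [Prod.mk.injEq, Subtype.mk.injEq] at h
    funext i
    have := congrFun h.2 i
    simp only [Function.update_apply] at this
    grind

theorem orbSize_colorPerm_swap_le {α : Type*} [Finite α] [DecidableEq α] (a b : α)
    (q : Quot (permOrbRel (colorPerm (swap a b)))) : orbSize q ≤ 2 := by
  obtain ⟨f, rfl⟩ := Quot.exists_rep q
  rw [orbSize_mk_s13]
  refine Function.IsPeriodicPt.minimalPeriod_le two_pos ?_
  rw [Function.IsPeriodicPt, Function.IsFixedPt, ← Perm.coe_pow, colorPerm_pow, sq,
    swap_mul_self]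
  rfl

theorem two_pow_cycleCount {α : Type*} [Finite α] (ρ : Perm α) :
    2 ^ cycleCount ρ = Nat.card {f : α → Bool // ∀ x, f (ρ x) = f x} := by
  have h : 2 ^ cycleCount ρ = Nat.card (Quot (permOrbRel ρ) → Bool) := by
    simp [cycleCount, Nat.card_fun]
  rw [h]
  refine Nat.card_congr (Equiv.ofBijective
    (fun k => ⟨fun x => k (Quot.mk _ x), fun x => congrArg k ?_⟩) ⟨fun k l hkl => ?_, fun f => ?_⟩)
  · exact quot_mk_eq_iff_sameCycle.2 (Perm.sameCycle_apply_left.2 .rfl)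
  · funext q
    obtain ⟨x, rfl⟩ := Quot.exists_rep q
    exact congrFun (congrArg Subtype.val hkl) x
  · refine ⟨fun q => f.1 q.out, Subtype.ext (funext fun x => ?_)⟩
    exact eq_apply_out_of_invariant f.2 x

theorem two_pow_cycleCount_prodCongr {α ι : Type*} [Finite α] [Finite ι] (σ : Perm α)
    (β : Perm ι) : 2 ^ cycleCount (Equiv.prodCongr σ β) =
      Nat.card {φ : ι → α → Bool // ∀ j, φ (β j) = colorPerm σ (φ j)} := by
  rw [two_pow_cycleCount]
  refine Nat.card_congr (Equiv.subtypeEquiv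
    ((Equiv.curry α ι Bool).trans (Equiv.piComm _)) fun f => ?_)
  simp only [Prod.forall, funext_iff, colorPerm_apply, Function.comp_apply]
  rw [forall_comm]
  refine forall_congr' fun j => ?_
  refine Iff.trans (forall_congr' fun i => ?_) σ.forall_congr_right
  simp [Equiv.piComm]

theorem sum_two_pow_cycleCount_prodCongr {α ι : Type*} [Fintype α] [DecidableEq α] [Fintype ι]
    [DecidableEq ι] (σ : Perm α) :
    ∑ β : Perm ι, 2 ^ cycleCount (Equiv.prodCongr σ β) =
      (invariantWeights (colorPerm σ) (Fintype.card ι)).card * Fintype.card (Perm ι) := by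
  rw [← sum_card_intertwining]
  refine Finset.sum_congr rfl fun β _ => ?_
  rw [two_pow_cycleCount_prodCongr, Nat.card_eq_fintype_card]

end

/-- Among the non-identity permutations `σ` of `Fin n`, a transposition `τ`
maximizes `Σ_{β ∈ S_r} 2^{c(σ × β)}` (for `2 ≤ n < r`). -/
theorem swap_term_maximal (n r : ℕ) (hn : 2 ≤ n) (hnr : n < r)
    (τ σ : Equiv.Perm (Fin n)) (hτ : τ.IsSwap) (hσ : σ ≠ 1) :
    ∑ β : Equiv.Perm (Fin r), 2 ^ cycleCount (Equiv.prodCongr σ β) ≤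
      ∑ β : Equiv.Perm (Fin r), 2 ^ cycleCount (Equiv.prodCongr τ β) := by
  obtain ⟨a, b, -, rfl⟩ := hτ
  obtain ⟨j, hj, hdvd⟩ := exists_injective_orbSize_dvd rfl
    (two_mul_card_odd_orbSize_colorPerm_le hσ)
    ((card_le_two_mul_card_fixed_colorPerm_swap a b).trans
      (Nat.mul_le_mul_left 2 (card_fixed_le_card_orbSize_eq_one _)))
    (orbSize_colorPerm_swap_le a b)
  rw [sum_two_pow_cycleCount_prodCongr, sum_two_pow_cycleCount_prodCongr]
  exact Nat.mul_le_mul_right _ (card_invariantWeights_le _ _ _ j hj hdvd)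
end
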